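/- Let d = 3 and suppose q = (q̄, q_n(q̄)) is a normalized central configuration satisfying the normalization y_{n−1} = z_{n−1} = z_{n−2} = 0. If det [[y_{n−2} − y_n, y_{n−1} − y_n], [x_{n−2} − x_n, x_{n−1} − x_n]] = 0 and q is non-collinear, then q is a degenerate solution of the reduced system RS, i.e. the Jacobian matrix D RS at the corresponding point is singular (its rank is strictly less than 3n − 6). -/

import Mathlib

open scoped BigOperators

noncomputable section

/-- Points in `ℝ^d`, with the Euclidean norm. -/
abbrev Pt (d : ℕ) := EuclideanSpace ℝ (Fin d)

/-- `F_i(q) = −q_i + Σ_{j ≠ i} m_j (q_j − q_i)/‖q_j − q_i‖³`. -/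
noncomputable def nbodyF {d n : ℕ} (m : Fin n → ℝ) (q : Fin n → Pt d) : Fin n → Pt d :=
  fun i => -q i + ∑ j ∈ Finset.univ.erase i, (m j / ‖q j - q i‖ ^ 3) • (q j - q i)

/-- A configuration is collision-free if all bodies occupy distinct positions. -/
def CollisionFree {d n : ℕ} (q : Fin n → Pt d) : Prop :=
  ∀ i j, i ≠ j → q i ≠ q j

/-- A normalized central configuration: collision-free, center of mass at the origin,
and `F(q) = 0`. -/
def IsNCC {d n : ℕ} (m : Fin n → ℝ) (q : Fin n → Pt d) : Prop :=
  CollisionFree q ∧ (∑ i, m i • q i) = 0 ∧ nbodyF m q = 0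

/-- Embedding of the reduced index set `{1,…,n−1}` into `{1,…,n}`. -/
def emb {n : ℕ} (i : Fin (n - 1)) : Fin n := Fin.castLE (Nat.sub_le n 1) i

/-- Extend a reduced configuration `q̄ = (q_1,…,q_{n−1})` by the position of the last body,
`q_n(q̄) = −(1/m_n) Σ_{i<n} m_i q_i`, computed from the center of mass condition. -/
noncomputable def extendConfig {d n : ℕ} (m : Fin n → ℝ) (qbar : Fin (n - 1) → Pt d) :
    Fin n → Pt d :=
  fun i => if h : (i : ℕ) < n - 1 then qbar ⟨i, h⟩
    else (-(1 / m i)) • ∑ j : Fin (n - 1), m (emb j) • qbar j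

/-- The center-of-mass reduced map `F^red_i(q̄) = F_i(q_1,…,q_{n−1},q_n(q̄))`, `i = 1,…,n−1`. -/
noncomputable def Fred {d n : ℕ} (m : Fin n → ℝ) (qbar : Fin (n - 1) → Pt d) :
    Fin (n - 1) → Pt d :=
  fun i => nbodyF m (extendConfig m qbar) (emb i)

/-- The Jacobian matrix of `F`, rows and columns indexed by (body, coordinate). -/
noncomputable def jacF {d n : ℕ} (m : Fin n → ℝ) (q : Fin n → Pt d) :
    Matrix (Fin n × Fin d) (Fin n × Fin d) ℝ :=
  fun p p' =>
    fderiv ℝ (fun q' : Fin n → Pt d => nbodyF m q' p.1 p.2) q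
      (Pi.single p'.1 (EuclideanSpace.single p'.2 (1 : ℝ)))

/-- The Jacobian matrix of `F^red`, rows and columns indexed by (body, coordinate). -/
noncomputable def jacFred {d n : ℕ} (m : Fin n → ℝ) (qbar : Fin (n - 1) → Pt d) :
    Matrix (Fin (n - 1) × Fin d) (Fin (n - 1) × Fin d) ℝ :=
  fun p p' =>
    fderiv ℝ (fun q' : Fin (n - 1) → Pt d => Fred m q' p.1 p.2) qbar
      (Pi.single p'.1 (EuclideanSpace.single p'.2 (1 : ℝ)))

/-- The Jacobian matrix of the spatial reduced system `RS`: it is obtained from `DF^red`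
by removing the rows corresponding to `F^red_{n−1,y}`, `F^red_{n−1,z}`, `F^red_{n−2,z}` and
the columns corresponding to the variables `y_{n−1}`, `z_{n−1}`, `z_{n−2}`
(here `x = 0`, `y = 1`, `z = 2`; the bodies of paper-index `n−1`, `n−2` are `⟨n−2,_⟩`, `⟨n−3,_⟩`). -/
noncomputable def DRS3 {n : ℕ} (hn : 4 ≤ n) (m : Fin n → ℝ) (qbar : Fin (n - 1) → Pt 3) :
    Matrix
      {p : Fin (n - 1) × Fin 3 //
        p ≠ (⟨n - 2, by omega⟩, 1) ∧ p ≠ (⟨n - 2, by omega⟩, 2) ∧ p ≠ (⟨n - 3, by omega⟩, 2)}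
      {p : Fin (n - 1) × Fin 3 //
        p ≠ (⟨n - 2, by omega⟩, 1) ∧ p ≠ (⟨n - 2, by omega⟩, 2) ∧ p ≠ (⟨n - 3, by omega⟩, 2)} ℝ :=
  (jacFred m qbar).submatrix Subtype.val Subtype.val

theorem sum_smul_nbodyF {d n : ℕ} (m : Fin n → ℝ) (q : Fin n → Pt d) :
    ∑ i, m i • nbodyF m q i = -∑ i, m i • q i := by
  have hanti : ∑ i, ∑ j, (m i * m j / ‖q j - q i‖ ^ 3) • (q j - q i) = 0 := by
    have := IsAddTorsionFree.of_isTorsionFree ℝ (Pt d)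
    rw [← self_eq_neg]
    nth_rewrite 1 [Finset.sum_comm]
    simp_rw [← Finset.sum_neg_distrib]
    refine Finset.sum_congr rfl fun i _ => Finset.sum_congr rfl fun j _ => ?_
    rw [norm_sub_rev, mul_comm, ← smul_neg, neg_sub]
  have hterm : ∀ i, m i • nbodyF m q i =
      -(m i • q i) + ∑ j, (m i * m j / ‖q j - q i‖ ^ 3) • (q j - q i) := by
    intro i
    rw [nbodyF, smul_add, smul_neg, Finset.smul_sum,
      ← Finset.add_sum_erase _ _ (Finset.mem_univ i)]
    simp [smul_smul, mul_div_assoc]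
  simp_rw [hterm, Finset.sum_add_distrib, hanti, Finset.sum_neg_distrib, add_zero]

theorem sum_inner_skew_nbodyF {d n : ℕ} (m : Fin n → ℝ) (q : Fin n → Pt d)
    (L : Pt d →L[ℝ] Pt d) (hL : ∀ x, inner ℝ (L x) x = 0) :
    ∑ i, m i * inner ℝ (L (q i)) (nbodyF m q i) = 0 := by
  have hskew : ∀ x y, inner ℝ (L x) y = -inner ℝ (L y) x := by
    intro x y
    have h := hL (x + y)
    rw [map_add, inner_add_left, inner_add_right, inner_add_right, hL, hL] at h
    linarith
  have hanti : ∑ i, ∑ j, m i * m j / ‖q j - q i‖ ^ 3 * inner ℝ (L (q i)) (q j) = 0 := by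
    rw [← self_eq_neg]
    nth_rewrite 1 [Finset.sum_comm]
    simp_rw [← Finset.sum_neg_distrib]
    refine Finset.sum_congr rfl fun i _ => Finset.sum_congr rfl fun j _ => ?_
    rw [norm_sub_rev, mul_comm (m j), hskew, mul_neg]
  have hterm : ∀ i, m i * inner ℝ (L (q i)) (nbodyF m q i) =
      ∑ j, m i * m j / ‖q j - q i‖ ^ 3 * inner ℝ (L (q i)) (q j) := by
    intro i
    rw [nbodyF, inner_add_right, inner_neg_right, hL, neg_zero, zero_add, inner_sum,
      Finset.mul_sum, ← Finset.add_sum_erase _ _ (Finset.mem_univ i), hL, mul_zero, zero_add]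
    refine Finset.sum_congr rfl fun j _ => ?_
    rw [inner_smul_right, inner_sub_right, hL, sub_zero]
    ring
  simp_rw [hterm, hanti]

theorem sum_smul_extendConfig {d k : ℕ} (m : Fin (k + 1) → ℝ) (hm : m (Fin.last k) ≠ 0)
    (qbar : Fin k → Pt d) :
    ∑ i, m i • extendConfig (n := k + 1) m qbar i = 0 := by
  rw [Fin.sum_univ_castSucc]
  have hlast : m (Fin.last k) • extendConfig (n := k + 1) m qbar (Fin.last k) =
      -∑ j : Fin k, m j.castSucc • qbar j := by
    simp only [extendConfig, Fin.val_last, Nat.add_sub_cancel, lt_irrefl, dite_false, neg_smul,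
      smul_neg, smul_smul, mul_one_div_cancel hm, one_smul]
    rfl
  rw [hlast, ← sub_eq_add_neg, sub_eq_zero]
  refine Finset.sum_congr rfl fun j _ => ?_
  simp [extendConfig]

theorem sum_inner_skew_Fred {d k : ℕ} (m : Fin (k + 1) → ℝ) (hm : m (Fin.last k) ≠ 0)
    (qbar : Fin k → Pt d) (L : Pt d →L[ℝ] Pt d) (hL : ∀ x, inner ℝ (L x) x = 0) :
    ∑ i : Fin k, m i.castSucc *
      inner ℝ (L (qbar i - extendConfig (n := k + 1) m qbar (Fin.last k)))
        (Fred (n := k + 1) m qbar i) = 0 := by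
  set q := extendConfig (n := k + 1) m qbar with hq
  have h1 : ∑ i, m i * inner ℝ (L (q i - q (Fin.last k))) (nbodyF m q i) = 0 := by
    simp_rw [map_sub, inner_sub_left, mul_sub, Finset.sum_sub_distrib,
      sum_inner_skew_nbodyF m q L hL, ← inner_smul_right, ← inner_sum, sum_smul_nbodyF, hq,
      sum_smul_extendConfig m hm, neg_zero, inner_zero_right, sub_zero]
  rw [Fin.sum_univ_castSucc, sub_self, map_zero, inner_zero_left, mul_zero, add_zero] at h1
  rw [← h1]
  refine Finset.sum_congr rfl fun i _ => ?_
  have : q i.castSucc = qbar i := by simp [hq, extendConfig]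
  rw [this]
  rfl

theorem differentiableAt_nbodyF {d n : ℕ} (m : Fin n → ℝ) {q : Fin n → Pt d}
    (hq : CollisionFree q) (i : Fin n) :
    DifferentiableAt ℝ (fun q' => nbodyF m q' i) q := by
  unfold nbodyF
  refine DifferentiableAt.add (by fun_prop) (DifferentiableAt.fun_sum fun j hj => ?_)
  have hne : q j - q i ≠ 0 := sub_ne_zero.2 (hq j i (Finset.ne_of_mem_erase hj))
  have hd : DifferentiableAt ℝ (fun q' : Fin n → Pt d => q' j - q' i) q := by fun_prop
  have hs : DifferentiableAt ℝ (fun q' : Fin n → Pt d => m j / ‖q' j - q' i‖ ^ 3) q := by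
    simp only [div_eq_mul_inv]
    exact (((hd.norm ℝ hne).fun_pow 3).fun_inv
      (pow_ne_zero 3 (norm_ne_zero_iff.2 hne))).const_mul _
  exact hs.fun_smul hd

theorem differentiable_extendConfig {d n : ℕ} (m : Fin n → ℝ) :
    Differentiable ℝ (extendConfig (d := d) m) := by
  rw [differentiable_pi]
  intro i
  unfold extendConfig
  split_ifs <;> fun_prop

theorem differentiableAt_Fred {d n : ℕ} (m : Fin n → ℝ) {qbar : Fin (n - 1) → Pt d}
    (hq : CollisionFree (extendConfig m qbar)) (i : Fin (n - 1)) :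
    DifferentiableAt ℝ (fun q' => Fred m q' i) qbar :=
  (differentiableAt_nbodyF m hq (emb i)).comp qbar (differentiable_extendConfig m qbar)

/-- The rows of the Jacobian of `F^red` at a central configuration satisfy the linear relation
obtained by differentiating the conservation of angular momentum. -/
theorem sum_skew_mul_jacFred {d k : ℕ} (m : Fin (k + 1) → ℝ) (hm : m (Fin.last k) ≠ 0)
    (qbar : Fin k → Pt d) (hcc : IsNCC m (extendConfig (n := k + 1) m qbar))
    (L : Pt d →L[ℝ] Pt d) (hL : ∀ x, inner ℝ (L x) x = 0) (p' : Fin k × Fin d) :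
    ∑ p : Fin k × Fin d, m p.1.castSucc *
      L (qbar p.1 - extendConfig (n := k + 1) m qbar (Fin.last k)) p.2 *
        jacFred (n := k + 1) m qbar p p' = 0 := by
  let A : Fin k × Fin d → (Fin k → Pt d) → ℝ := fun p q' =>
    m p.1.castSucc * L (q' p.1 - extendConfig (n := k + 1) m q' (Fin.last k)) p.2
  let B : Fin k × Fin d → (Fin k → Pt d) → ℝ := fun p q' => Fred (n := k + 1) m q' p.1 p.2
  have hA : ∀ p, DifferentiableAt ℝ (A p) qbar := by
    intro p
    have h := differentiable_pi.1 (differentiable_extendConfig (d := d) (n := k + 1) m)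
      (Fin.last k) qbar
    have h' : DifferentiableAt ℝ (fun q' : Fin k → Pt d => q' p.1) qbar := by fun_prop
    have h2 := (EuclideanSpace.proj p.2 : Pt d →L[ℝ] ℝ).differentiableAt.comp qbar
      (L.differentiableAt.comp qbar (h'.sub h))
    exact h2.const_mul _
  have hB : ∀ p, DifferentiableAt ℝ (B p) qbar := fun p =>
    (EuclideanSpace.proj p.2 : Pt d →L[ℝ] ℝ).differentiableAt.comp qbar
      (differentiableAt_Fred (n := k + 1) m hcc.1 p.1)
  have hB0 : ∀ p, B p qbar = 0 := by
    intro p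
    have h := congrFun hcc.2.2 (emb (n := k + 1) p.1)
    change nbodyF m (extendConfig (n := k + 1) m qbar) (emb (n := k + 1) p.1) p.2 = 0
    rw [h]
    rfl
  have hAB : (fun q' => ∑ p, A p q' * B p q') = fun _ => 0 := by
    funext q'
    rw [← sum_inner_skew_Fred m hm q' L hL, Fintype.sum_prod_type]
    refine Finset.sum_congr rfl fun i _ => ?_
    rw [PiLp.inner_apply, Finset.mul_sum]
    refine Finset.sum_congr rfl fun c _ => ?_
    simp only [A, B, RCLike.inner_apply, conj_trivial]
    ring
  have hder : fderiv ℝ (fun q' => ∑ p, A p q' * B p q') qbar =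
      ∑ p, A p qbar • fderiv ℝ (B p) qbar := by
    rw [fderiv_fun_sum fun p _ => (hA p).fun_mul (hB p)]
    refine Finset.sum_congr rfl fun p _ => ?_
    rw [fderiv_fun_mul (hA p) (hB p), hB0, zero_smul, add_zero]
  rw [hAB, fderiv_fun_const] at hder
  have h := congrArg
    (fun T => T (Pi.single p'.1 (EuclideanSpace.single p'.2 (1 : ℝ)))) hder.symm
  simpa [A, B, jacFred, sum_apply] using h

/-- The linear map `x ↦ ω × x` on Euclidean space. -/
noncomputable def crossCLM (ω : Fin 3 → ℝ) : Pt 3 →L[ℝ] Pt 3 :=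
  LinearMap.toContinuousLinearMap
    { toFun := fun x =>
        !₂[ω 1 * x 2 - ω 2 * x 1, ω 2 * x 0 - ω 0 * x 2, ω 0 * x 1 - ω 1 * x 0]
      map_add' := fun x y => by ext c; fin_cases c <;> simp <;> ring
      map_smul' := fun a x => by ext c; fin_cases c <;> simp <;> ring }

theorem crossCLM_apply (ω : Fin 3 → ℝ) (x : Pt 3) : crossCLM ω x =
    !₂[ω 1 * x 2 - ω 2 * x 1, ω 2 * x 0 - ω 0 * x 2, ω 0 * x 1 - ω 1 * x 0] := rfl

theorem inner_crossCLM_self (ω : Fin 3 → ℝ) (x : Pt 3) : inner ℝ (crossCLM ω x) x = 0 := by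
  simp [crossCLM_apply, PiLp.inner_apply, Fin.sum_univ_three]
  ring

theorem exists_smul_of_crossCLM_eq_zero {ω : Fin 3 → ℝ} (hω : ω ≠ 0) {x : Pt 3}
    (hx : crossCLM ω x = 0) : ∃ r : ℝ, x = r • WithLp.toLp 2 ω := by
  have h0 : ω 1 * x 2 - ω 2 * x 1 = 0 := congrArg (fun y : Pt 3 => y 0) hx
  have h1 : ω 2 * x 0 - ω 0 * x 2 = 0 := congrArg (fun y : Pt 3 => y 1) hx
  have h2 : ω 0 * x 1 - ω 1 * x 0 = 0 := congrArg (fun y : Pt 3 => y 2) hx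
  obtain ⟨c, hc⟩ := Function.ne_iff.1 hω
  rw [Pi.zero_apply] at hc
  refine ⟨x c / ω c, ?_⟩
  ext e
  rw [PiLp.smul_apply, smul_eq_mul, div_mul_eq_mul_div, eq_div_iff hc]
  fin_cases c <;> fin_cases e <;> simp <;> linarith

theorem collinear_of_crossCLM_eq_zero {ι : Type*} {q : ι → Pt 3} {ω : Fin 3 → ℝ} (hω : ω ≠ 0)
    (i₀ : ι) (h : ∀ i, crossCLM ω (q i - q i₀) = 0) : Collinear ℝ (Set.range q) := by
  rw [collinear_iff_of_mem (Set.mem_range_self i₀)]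
  refine ⟨WithLp.toLp 2 ω, ?_⟩
  rintro _ ⟨i, rfl⟩
  obtain ⟨r, hr⟩ := exists_smul_of_crossCLM_eq_zero hω (h i)
  exact ⟨r, by rw [← hr, vadd_eq_add, sub_add_cancel]⟩

/-- A nonzero `ω` for which `ω × u` is parallel to the first axis and `ω × v` is horizontal. -/
theorem exists_crossCLM_apply_eq_zero (u v : Pt 3) (h : v 1 * u 0 - u 1 * v 0 = 0) :
    ∃ ω : Fin 3 → ℝ, ω ≠ 0 ∧ crossCLM ω u 1 = 0 ∧ crossCLM ω u 2 = 0 ∧ crossCLM ω v 2 = 0 := by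
  have hdet : (!![-u 2, 0, u 0; u 1, -u 0, 0; v 1, -v 0, 0]).det = 0 := by
    rw [Matrix.det_fin_three]
    simp
    linear_combination u 0 * h
  obtain ⟨ω, hω, hz⟩ := Matrix.exists_mulVec_eq_zero_iff.2 hdet
  have h0 := congrFun hz 0
  have h1 := congrFun hz 1
  have h2 := congrFun hz 2
  simp [Matrix.mulVec, dotProduct, Fin.sum_univ_three] at h0 h1 h2
  refine ⟨ω, hω, ?_, ?_, ?_⟩ <;> simp [crossCLM_apply] <;> linarith

theorem rank_lt_card_of_vecMul_eq_zero {ι K : Type*} [Fintype ι] [Field K]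
    {M : Matrix ι ι K} {w : ι → K} (hw : w ≠ 0) (h : Matrix.vecMul w M = 0) :
    M.rank < Fintype.card ι := by
  classical
  refine lt_of_le_of_ne M.rank_le_card_height fun hr => hw ?_
  have hli : LinearIndependent K M.row := by
    rw [linearIndependent_iff_card_eq_finrank_span, Set.finrank, ← Matrix.rank_eq_finrank_span_row,
      hr]
  exact Matrix.vecMul_injective_iff.2 hli (h.trans (Matrix.zero_vecMul M).symm)

theorem card_subtype_ne_three {α : Type*} [Fintype α] [DecidableEq α] {a b c : α}
    (hab : a ≠ b) (hac : a ≠ c) (hbc : b ≠ c) :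
    Fintype.card {p : α // p ≠ a ∧ p ≠ b ∧ p ≠ c} = Fintype.card α - 3 := by
  rw [Fintype.card_subtype, ← Finset.card_eq_three.2 ⟨a, b, c, hab, hac, hbc, rfl⟩,
    ← Finset.card_compl]
  congr 1
  ext p
  simp

/-- for a spatial nCC with the normalization `y_{n−1} = z_{n−1} = z_{n−2} = 0`,
if the 2×2 determinant vanishes and the configuration is non-collinear, then `D RS` is
singular, i.e. its rank is `< 3n − 6`. -/
theorem stmt14 {n : ℕ} (hn : 4 ≤ n) (m : Fin n → ℝ) (hm : ∀ i, 0 < m i)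
    (qbar : Fin (n - 1) → Pt 3) (hcc : IsNCC m (extendConfig m qbar))
    (hy1 : qbar ⟨n - 2, by omega⟩ 1 = 0) (hz1 : qbar ⟨n - 2, by omega⟩ 2 = 0)
    (hz2 : qbar ⟨n - 3, by omega⟩ 2 = 0)
    (hdet :
      (!![qbar ⟨n - 3, by omega⟩ 1 - extendConfig m qbar ⟨n - 1, by omega⟩ 1,
          qbar ⟨n - 2, by omega⟩ 1 - extendConfig m qbar ⟨n - 1, by omega⟩ 1;
          qbar ⟨n - 3, by omega⟩ 0 - extendConfig m qbar ⟨n - 1, by omega⟩ 0,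
          qbar ⟨n - 2, by omega⟩ 0 - extendConfig m qbar ⟨n - 1, by omega⟩ 0]).det = 0)
    (hnc : ¬ Collinear ℝ (Set.range (extendConfig m qbar))) :
    (DRS3 hn m qbar).rank < 3 * n - 6 := by
  obtain ⟨k, rfl⟩ : ∃ k, n = k + 1 := ⟨n - 1, by omega⟩
  set q := extendConfig m qbar with hq
  have hq_cast : ∀ i : Fin k, q i.castSucc = qbar i := fun i => by simp [hq, extendConfig]
  obtain ⟨ω, hω, hu1, hu2, hv2⟩ := exists_crossCLM_apply_eq_zero
    (qbar ⟨k - 1, by omega⟩ - q (Fin.last k)) (qbar ⟨k - 2, by omega⟩ - q (Fin.last k))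
    (by rw [Matrix.det_fin_two] at hdet; exact hdet)
  let w : Fin k × Fin 3 → ℝ := fun p =>
    m p.1.castSucc * crossCLM ω (qbar p.1 - q (Fin.last k)) p.2
  have hw0 : ∀ p, ¬ (p ≠ (⟨k - 1, by omega⟩, 1) ∧ p ≠ (⟨k - 1, by omega⟩, 2) ∧
      p ≠ (⟨k - 2, by omega⟩, 2)) → w p = 0 := by
    intro p hp
    have : p = (⟨k - 1, by omega⟩, 1) ∨ p = (⟨k - 1, by omega⟩, 2) ∨
      p = (⟨k - 2, by omega⟩, 2) := by tauto
    rcases this with rfl | rfl | rfl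
    · exact mul_eq_zero_of_right _ hu1
    · exact mul_eq_zero_of_right _ hu2
    · exact mul_eq_zero_of_right _ hv2
  have hcard := card_subtype_ne_three (α := Fin k × Fin 3)
    (a := (⟨k - 1, by omega⟩, 1)) (b := (⟨k - 1, by omega⟩, 2)) (c := (⟨k - 2, by omega⟩, 2))
    (by simp) (by simp) (by simp; omega)
  rw [Fintype.card_prod, Fintype.card_fin, Fintype.card_fin] at hcard
  have hsize : 3 * (k + 1) - 6 = k * 3 - 3 := by omega
  rw [hsize, ← hcard]
  refine rank_lt_card_of_vecMul_eq_zero (w := fun p => w p.1) ?_ ?_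
  · intro hw
    refine hnc (collinear_of_crossCLM_eq_zero hω (Fin.last k) fun i => ?_)
    induction i using Fin.lastCases with
    | last => rw [sub_self, map_zero]
    | cast i =>
      rw [hq_cast]
      ext c
      have : w (i, c) = 0 := by
        by_cases hp : ((i, c) : Fin k × Fin 3) ≠ (⟨k - 1, by omega⟩, 1) ∧
            (i, c) ≠ (⟨k - 1, by omega⟩, 2) ∧ (i, c) ≠ (⟨k - 2, by omega⟩, 2)
        · exact congrFun hw ⟨(i, c), hp⟩
        · exact hw0 _ hp
      exact (mul_eq_zero.1 this).resolve_left (hm _).ne'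
  · funext p'
    rw [Pi.zero_apply, ← sum_skew_mul_jacFred m (hm _).ne' qbar hcc (crossCLM ω)
      (inner_crossCLM_self ω) p'.1]
    change ∑ p : {p : Fin k × Fin 3 // _}, w p.1 * jacFred (n := k + 1) m qbar p.1 p'.1 =
      ∑ p, w p * jacFred (n := k + 1) m qbar p p'.1
    rw [← Fintype.sum_subtype_add_sum_subtype (fun p : Fin k × Fin 3 =>
      p ≠ (⟨k - 1, by omega⟩, 1) ∧ p ≠ (⟨k - 1, by omega⟩, 2) ∧ p ≠ (⟨k - 2, by omega⟩, 2))]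
    refine (add_eq_left.2 <| Finset.sum_eq_zero fun p _ => ?_).symm
    rw [hw0 _ p.2, zero_mul]
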